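/- For n ≤ 3, the inner and outer bounds coincide: con(Ω_{s,n} ∪ {φ^n_1,…,φ^n_n}) = con(Υ_{s,n}) = con(γ*_{s,n}). In particular, for n ≤ 3 the closed convex cone generated by the s-Gaussian functions equals the closed convex cone generated by the s-representable functions together with φ^n_1,…,φ^n_n. -/

import Mathlib

open MeasureTheory

noncomputable section

/-- The principal submatrix of `K` with rows and columns indexed by `α`. -/
def principalSub {n : ℕ} (K : Matrix (Fin n) (Fin n) ℝ) (α : Finset (Fin n)) :
    Matrix {i // i ∈ α} {i // i ∈ α} ℝ :=
  K.submatrix (fun i => i.1) (fun i => i.1)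

/-- A closed convex cone: a closed convex set stable under positive scaling. -/
def IsClosedConvexCone {E : Type*} [AddCommMonoid E] [Module ℝ E] [TopologicalSpace E]
    (C : Set E) : Prop :=
  IsClosed C ∧ Convex ℝ C ∧ ∀ c : ℝ, 0 < c → ∀ x ∈ C, c • x ∈ C

/-- `ccc S` is the smallest closed convex cone containing `S`. -/
def ccc {E : Type*} [AddCommMonoid E] [Module ℝ E] [TopologicalSpace E] (S : Set E) : Set E :=
  ⋂₀ {C : Set E | IsClosedConvexCone C ∧ S ⊆ C}

/-- `Wscale S` is the set of positive scalar multiples of elements of `S`. -/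
def Wscale {E : Type*} [SMul ℝ E] (S : Set E) : Set E :=
  {h | ∃ c : ℝ, 0 < c ∧ ∃ g ∈ S, h = c • g}

/-- The rank function `φⁿᵢ`. -/
def phiFn (n : ℕ) (i : Fin n) : Finset (Fin n) → ℝ :=
  fun α => if i ∈ α then -1 else 0

/-- s-Gaussian rank functions: differential entropy functions of `n` jointly Gaussian
scalar random variables with positive definite covariance matrix. -/
def IsSGaussian (n : ℕ) (g : Finset (Fin n) → ℝ) : Prop :=
  ∃ K : Matrix (Fin n) (Fin n) ℝ, K.PosDef ∧
    ∀ α : Finset (Fin n),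
      g α = 1 / 2 * Real.logb 2
        ((2 * Real.pi * Real.exp 1) ^ α.card * (principalSub K α).det)

/-- The principal submatrix on the blocks indexed by `α`. -/
def vPrincipal {n : ℕ} {k : Fin n → ℕ}
    (K : Matrix ((i : Fin n) × Fin (k i)) ((i : Fin n) × Fin (k i)) ℝ)
    (α : Finset (Fin n)) :
    Matrix {p : (i : Fin n) × Fin (k i) // p.1 ∈ α}
      {p : (i : Fin n) × Fin (k i) // p.1 ∈ α} ℝ :=
  K.submatrix (fun p => p.1) (fun p => p.1)

/-- v-Gaussian rank functions: differential entropy functions of `n` jointly Gaussian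
random vectors of positive lengths `k i`, with positive definite joint covariance. -/
def IsVGaussian (n : ℕ) (g : Finset (Fin n) → ℝ) : Prop :=
  ∃ k : Fin n → ℕ, (∀ i, 0 < k i) ∧
    ∃ K : Matrix ((i : Fin n) × Fin (k i)) ((i : Fin n) × Fin (k i)) ℝ, K.PosDef ∧
      ∀ α : Finset (Fin n),
        g α = 1 / 2 * Real.logb 2
          ((2 * Real.pi * Real.exp 1) ^ (∑ i ∈ α, k i) * (vPrincipal K α).det)

/-- Normalised Gaussian entropy functions: all blocks have common length `T`, and the
entropy function is multiplied by `1/T`. -/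
def IsNormGaussian (n : ℕ) (g : Finset (Fin n) → ℝ) : Prop :=
  ∃ T : ℕ, 0 < T ∧
    ∃ K : Matrix (Fin n × Fin T) (Fin n × Fin T) ℝ, K.PosDef ∧
      ∀ α : Finset (Fin n),
        g α = (1 / (T : ℝ)) * (1 / 2 * Real.logb 2
          ((2 * Real.pi * Real.exp 1) ^ (T * α.card) *
            (K.submatrix (fun p : {p : Fin n × Fin T // p.1 ∈ α} => p.1)
              (fun p => p.1)).det))

/-- `g` is the differential entropy function of scalar random variables `X`:
the joint law has a density, every nonempty subtuple has a density whose entropy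
integrand is integrable, `g ∅ = 0`, and `g α = h(X_α)` (base-2). -/
def SEntropyData (n : ℕ) (Ω : Type) [MeasureSpace Ω] (X : Fin n → Ω → ℝ)
    (g : Finset (Fin n) → ℝ) : Prop :=
  IsProbabilityMeasure (volume : Measure Ω) ∧
  Measurable (fun ω i => X i ω) ∧
  (∃ f : (Fin n → ℝ) → ℝ, Measurable f ∧ (∀ x, 0 ≤ f x) ∧
    Measure.map (fun ω i => X i ω) volume
      = volume.withDensity fun x => ENNReal.ofReal (f x)) ∧
  g ∅ = 0 ∧
  ∀ α : Finset (Fin n), α.Nonempty →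
    ∃ f : ({i // i ∈ α} → ℝ) → ℝ, Measurable f ∧ (∀ x, 0 ≤ f x) ∧
      Measure.map (fun ω (i : {i // i ∈ α}) => X i.1 ω) volume
        = volume.withDensity (fun x => ENNReal.ofReal (f x)) ∧
      Integrable (fun x => f x * Real.logb 2 (f x)) ∧
      g α = -∫ x, f x * Real.logb 2 (f x)

/-- s-entropic rank functions. -/
def IsSEntropic (n : ℕ) (g : Finset (Fin n) → ℝ) : Prop :=
  ∃ (Ω : Type) (m : MeasureSpace Ω) (X : Fin n → Ω → ℝ), @SEntropyData n Ω m X g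

/-- `g` is the differential entropy function of random vectors `X i : Ω → ℝ^{k i}`. -/
def VEntropyData (n : ℕ) (k : Fin n → ℕ) (Ω : Type) [MeasureSpace Ω]
    (X : (i : Fin n) → Ω → (Fin (k i) → ℝ)) (g : Finset (Fin n) → ℝ) : Prop :=
  IsProbabilityMeasure (volume : Measure Ω) ∧
  Measurable (fun ω (i : Fin n) => X i ω) ∧
  (∃ f : ((i : Fin n) → Fin (k i) → ℝ) → ℝ, Measurable f ∧ (∀ x, 0 ≤ f x) ∧
    Measure.map (fun ω (i : Fin n) => X i ω) volume
      = volume.withDensity fun x => ENNReal.ofReal (f x)) ∧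
  g ∅ = 0 ∧
  ∀ α : Finset (Fin n), α.Nonempty →
    ∃ f : ((i : {i // i ∈ α}) → Fin (k i.1) → ℝ) → ℝ, Measurable f ∧ (∀ x, 0 ≤ f x) ∧
      Measure.map (fun ω (i : {i // i ∈ α}) => X i.1 ω) volume
        = volume.withDensity (fun x => ENNReal.ofReal (f x)) ∧
      Integrable (fun x => f x * Real.logb 2 (f x)) ∧
      g α = -∫ x, f x * Real.logb 2 (f x)

/-- v-entropic rank functions. -/
def IsVEntropic (n : ℕ) (g : Finset (Fin n) → ℝ) : Prop :=
  ∃ k : Fin n → ℕ, (∀ i, 0 < k i) ∧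
    ∃ (Ω : Type) (m : MeasureSpace Ω) (X : (i : Fin n) → Ω → (Fin (k i) → ℝ)),
      @VEntropyData n k Ω m X g

/-- s-representable rank functions. -/
def IsSRepresentable (n : ℕ) (g : Finset (Fin n) → ℝ) : Prop :=
  ∃ (k : ℕ) (A : Fin n → Fin k → ℝ),
    ∀ α : Finset (Fin n),
      g α = (Module.finrank ℝ ↥(Submodule.span ℝ (A '' (α : Set (Fin n)))) : ℝ)

/-- v-representable rank functions. -/
def IsVRepresentable (n : ℕ) (g : Finset (Fin n) → ℝ) : Prop :=
  ∃ (d : ℕ) (k : Fin n → ℕ) (A : (i : Fin n) → Fin (k i) → (Fin d → ℝ)),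
    ∀ α : Finset (Fin n),
      g α = (Module.finrank ℝ
        ↥(Submodule.span ℝ {v : Fin d → ℝ | ∃ i ∈ α, ∃ j, v = A i j}) : ℝ)

/-- The marginal probability mass function of a joint pmf `p` on the coordinates in `α`. -/
def marginalPMF {n : ℕ} (S : Fin n → ℕ) (p : ((i : Fin n) → Fin (S i)) → ℝ)
    (α : Finset (Fin n)) (x : (i : {i // i ∈ α}) → Fin (S i.1)) : ℝ :=
  ∑ y : (i : Fin n) → Fin (S i), if ∀ i : {i // i ∈ α}, y i.1 = x i then p y else 0

/-- The Shannon entropy (base 2) of the subtuple indexed by `α`. -/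
def discEntropyFn {n : ℕ} (S : Fin n → ℕ) (p : ((i : Fin n) → Fin (S i)) → ℝ)
    (α : Finset (Fin n)) : ℝ :=
  -∑ x : (i : {i // i ∈ α}) → Fin (S i.1),
    marginalPMF S p α x * Real.logb 2 (marginalPMF S p α x)

/-- Entropic rank functions: Shannon entropy functions of finitely-valued
discrete random variables. -/
def IsEntropic (n : ℕ) (g : Finset (Fin n) → ℝ) : Prop :=
  ∃ (S : Fin n → ℕ) (p : ((i : Fin n) → Fin (S i)) → ℝ),
    (∀ x, 0 ≤ p x) ∧ (∑ x, p x = 1) ∧ ∀ α, g α = discEntropyFn S p α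

/-- The Ingleton inequality for a rank function on four variables. -/
def IngletonIneq (g : Finset (Fin 4) → ℝ) (i j k l : Fin 4) : Prop :=
  g {i} + g {j} + g {k, l} + g {i, j, k} + g {i, j, l} ≤
    g {i, j} + g {i, k} + g {i, l} + g {j, k} + g {j, l}

section ClosedConvexCone

variable {E : Type*} [AddCommMonoid E] [Module ℝ E] [TopologicalSpace E]

theorem subset_ccc (S : Set E) : S ⊆ ccc S := fun _ hx _ hC => hC.2 hx

theorem ccc_subset {S C : Set E} (hC : IsClosedConvexCone C) (h : S ⊆ C) : ccc S ⊆ C :=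
  fun _ hx => hx C ⟨hC, h⟩

theorem isClosedConvexCone_ccc (S : Set E) : IsClosedConvexCone (ccc S) :=
  ⟨isClosed_sInter fun _ hC => hC.1.1, convex_sInter fun _ hC => hC.1.2.1,
    fun c hc _ hx C hC => hC.1.2.2 c hc _ (hx C hC)⟩

theorem ccc_subset_ccc {S T : Set E} (h : S ⊆ ccc T) : ccc S ⊆ ccc T :=
  ccc_subset (isClosedConvexCone_ccc T) h

namespace IsClosedConvexCone

variable {C : Set E}

theorem add_mem (hC : IsClosedConvexCone C) {x y : E} (hx : x ∈ C) (hy : y ∈ C) :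
    x + y ∈ C := by
  have h := hC.2.1 (hC.2.2 2 two_pos x hx) (hC.2.2 2 two_pos y hy)
    (show (0 : ℝ) ≤ 1 / 2 by norm_num) (show (0 : ℝ) ≤ 1 / 2 by norm_num) (by norm_num)
  simpa [smul_smul] using h

theorem smul_mem (hC : IsClosedConvexCone C) (h0 : (0 : E) ∈ C) {c : ℝ} (hc : 0 ≤ c) {x : E}
    (hx : x ∈ C) : c • x ∈ C := by
  rcases hc.eq_or_lt with rfl | hc
  · simpa using h0
  · exact hC.2.2 c hc x hx

end IsClosedConvexCone

end ClosedConvexCone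

/-- The cone of submodular rank functions that vanish on the empty set. -/
def submodularCone (n : ℕ) : Set (Finset (Fin n) → ℝ) :=
  {g | g ∅ = 0 ∧ ∀ α β : Finset (Fin n), g (α ∪ β) + g (α ∩ β) ≤ g α + g β}

theorem isClosedConvexCone_submodularCone (n : ℕ) : IsClosedConvexCone (submodularCone n) := by
  refine ⟨?_, ?_, ?_⟩
  · rw [submodularCone, Set.ofPred_and]
    refine (isClosed_eq (by fun_prop) (by fun_prop)).inter ?_
    simp only [Set.ofPred_forall]
    exact isClosed_iInter fun α => isClosed_iInter fun β =>
      isClosed_le (by fun_prop) (by fun_prop)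
  · rintro x ⟨hx0, hx⟩ y ⟨hy0, hy⟩ a b ha hb -
    refine ⟨by simp [hx0, hy0], fun α β => ?_⟩
    have h₁ := mul_le_mul_of_nonneg_left (hx α β) ha
    have h₂ := mul_le_mul_of_nonneg_left (hy α β) hb
    simp only [Pi.add_apply, Pi.smul_apply, smul_eq_mul]
    linarith
  · rintro c hc x ⟨hx0, hx⟩
    refine ⟨by simp [hx0], fun α β => ?_⟩
    have h₁ := mul_le_mul_of_nonneg_left (hx α β) hc.le
    simp only [Pi.smul_apply, smul_eq_mul]
    linarith

/-- The rank function of the uniform matroid of rank one on `A`. -/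
def uniformRankOne {n : ℕ} (A : Finset (Fin n)) : Finset (Fin n) → ℝ :=
  fun α => if (α ∩ A).Nonempty then 1 else 0

/-- The rank function of the uniform matroid of rank two on all elements. -/
def uniformRankTwo (n : ℕ) : Finset (Fin n) → ℝ := fun α => min 2 α.card

theorem isSRepresentable_uniformRankOne {n : ℕ} (A : Finset (Fin n)) :
    IsSRepresentable n (uniformRankOne A) := by
  refine ⟨1, fun i => if i ∈ A then 1 else 0, fun α => ?_⟩
  by_cases h : (α ∩ A).Nonempty
  · obtain ⟨i, hi⟩ := h
    rw [Finset.mem_inter] at hi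
    have : Submodule.span ℝ ((fun i => if i ∈ A then (1 : Fin 1 → ℝ) else 0) '' (α : Set (Fin n)))
        = ⊤ := by
      rw [eq_top_iff]
      rintro x -
      have hx : x = x 0 • (1 : Fin 1 → ℝ) := by ext j; simp [Subsingleton.elim j 0]
      rw [hx]
      exact Submodule.smul_mem _ _ (Submodule.subset_span ⟨i, hi.1, by simp [hi.2]⟩)
    rw [this]
    simp [uniformRankOne, show (α ∩ A).Nonempty from ⟨i, by simp [hi]⟩]
  · have : Submodule.span ℝ ((fun i => if i ∈ A then (1 : Fin 1 → ℝ) else 0) '' (α : Set (Fin n)))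
        = ⊥ := by
      rw [Submodule.span_eq_bot]
      rintro _ ⟨i, hi, rfl⟩
      have : i ∉ A := fun hA => h ⟨i, by simpa using ⟨hi, hA⟩⟩
      simp [this]
    rw [this]
    simp [uniformRankOne, h]

theorem isSRepresentable_uniformRankTwo (n : ℕ) : IsSRepresentable n (uniformRankTwo n) := by
  refine ⟨2, fun i => ![1, (i : ℝ)], fun α => ?_⟩
  rcases Nat.lt_or_ge 1 α.card with h | h
  · obtain ⟨i, hi, j, hj, hij⟩ := Finset.one_lt_card.1 h
    have hd : (j : ℝ) - i ≠ 0 := by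
      rw [sub_ne_zero]
      exact_mod_cast fun h : (j : ℕ) = i => hij (Fin.ext h.symm)
    have : Submodule.span ℝ ((fun i : Fin n => ![1, (i : ℝ)]) '' (α : Set (Fin n))) = ⊤ := by
      rw [eq_top_iff]
      rintro x -
      have hx : x = ((x 0 * j - x 1) / (j - i)) • ![1, (i : ℝ)]
          + ((x 1 - i * x 0) / (j - i)) • ![1, (j : ℝ)] := by
        ext k
        fin_cases k <;> simp <;> field_simp <;> ring
      rw [hx]
      exact add_mem (Submodule.smul_mem _ _ (Submodule.subset_span ⟨i, hi, rfl⟩))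
        (Submodule.smul_mem _ _ (Submodule.subset_span ⟨j, hj, rfl⟩))
    rw [this]
    simpa [uniformRankTwo] using Nat.succ_le_of_lt h
  · rcases Nat.le_one_iff_eq_zero_or_eq_one.1 h with h | h
    · obtain rfl := Finset.card_eq_zero.1 h
      rw [Finset.coe_empty, Set.image_empty, Submodule.span_empty, finrank_bot]
      simp [uniformRankTwo]
    obtain ⟨i, rfl⟩ := Finset.card_eq_one.1 h
    have h0 : ![1, (i : ℝ)] ≠ 0 := fun h => by simpa using congrFun h 0
    rw [Finset.coe_singleton, Set.image_singleton, finrank_span_singleton h0]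
    simp [uniformRankTwo]

theorem smul_uniformRankOne_singleton_mem {n : ℕ} (c : ℝ) (i : Fin n) :
    c • uniformRankOne {i} ∈ ccc ({g : Finset (Fin n) → ℝ | IsSRepresentable n g} ∪
        {g | ∃ i : Fin n, g = phiFn n i}) := by
  rcases lt_trichotomy c 0 with hc | rfl | hc
  · have h : c • uniformRankOne {i} = (-c) • phiFn n i := by
      ext α
      by_cases hi : i ∈ α <;> simp [uniformRankOne, phiFn, hi]
    rw [h]
    exact (isClosedConvexCone_ccc _).2.2 _ (by linarith) _ (subset_ccc _ (Or.inr ⟨i, rfl⟩))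
  · have h : (0 : ℝ) • uniformRankOne {i} = uniformRankOne (∅ : Finset (Fin n)) := by
      ext α
      simp [uniformRankOne]
    rw [h]
    exact subset_ccc _ (Or.inl (isSRepresentable_uniformRankOne _))
  · exact (isClosedConvexCone_ccc _).2.2 _ hc _
      (subset_ccc _ (Or.inl (isSRepresentable_uniformRankOne _)))

theorem submodularCone_subset {n : ℕ} (hn : n ≤ 3) :
    submodularCone n ⊆ ccc ({g : Finset (Fin n) → ℝ | IsSRepresentable n g} ∪
        {g | ∃ i : Fin n, g = phiFn n i}) := by
  rintro g ⟨h0, hg⟩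
  set C := ccc ({g : Finset (Fin n) → ℝ | IsSRepresentable n g} ∪
    {g | ∃ i : Fin n, g = phiFn n i}) with hC
  have cone : IsClosedConvexCone C := isClosedConvexCone_ccc _
  have one_mem : ∀ A, uniformRankOne A ∈ C := fun A =>
    subset_ccc _ (Or.inl (isSRepresentable_uniformRankOne A))
  have two_mem : uniformRankTwo n ∈ C :=
    subset_ccc _ (Or.inl (isSRepresentable_uniformRankTwo n))
  have single_mem : ∀ (c : ℝ) i, c • uniformRankOne {i} ∈ C :=
    smul_uniformRankOne_singleton_mem
  have zero_mem : (0 : Finset (Fin n) → ℝ) ∈ C := by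
    have h : (0 : Finset (Fin n) → ℝ) = uniformRankOne ∅ := by
      ext α
      simp [uniformRankOne]
    exact h ▸ one_mem ∅
  clear_value C
  interval_cases n
  · have h : g = 0 := funext fun α => by rw [Subsingleton.elim α ∅, h0]; rfl
    exact h ▸ zero_mem
  · have h : g = g {0} • uniformRankOne {0} := by
      ext α
      have hα : ∀ α : Finset (Fin 1), α = ∅ ∨ α = {0} := by decide
      rcases hα α with rfl | rfl <;> simp [uniformRankOne, h0]
    rw [h]
    exact single_mem _ _
  · have hI := hg {0} {1}
    rw [show ({0} ∪ {1} : Finset (Fin 2)) = {0, 1} by decide,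
      show ({0} ∩ {1} : Finset (Fin 2)) = ∅ by decide, h0] at hI
    have h : g = (g {0} + g {1} - g {0, 1}) • uniformRankOne {0, 1}
        + (g {0, 1} - g {1}) • uniformRankOne {0} + (g {0, 1} - g {0}) • uniformRankOne {1} := by
      ext α
      have hα : ∀ α : Finset (Fin 2), α = ∅ ∨ α = {0} ∨ α = {1} ∨ α = {0, 1} := by decide
      rcases hα α with rfl | rfl | rfl | rfl <;> simp [uniformRankOne, h0]
    rw [h]
    exact cone.add_mem (cone.add_mem (cone.smul_mem zero_mem (by linarith) (one_mem _))
      (single_mem _ _)) (single_mem _ _)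
  · have hα : ∀ α : Finset (Fin 3), α = ∅ ∨ α = {0} ∨ α = {1} ∨ α = {2} ∨ α = {0, 1} ∨
        α = {0, 2} ∨ α = {1, 2} ∨ α = {0, 1, 2} := by decide
    have hI01 := hg {0} {1}
    have hI02 := hg {0} {2}
    have hI12 := hg {1} {2}
    have hJ01 := hg {0, 2} {1, 2}
    have hJ02 := hg {0, 1} {1, 2}
    have hJ12 := hg {0, 1} {0, 2}
    rw [show ({0} ∪ {1} : Finset (Fin 3)) = {0, 1} by decide,
      show ({0} ∩ {1} : Finset (Fin 3)) = ∅ by decide, h0] at hI01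
    rw [show ({0} ∪ {2} : Finset (Fin 3)) = {0, 2} by decide,
      show ({0} ∩ {2} : Finset (Fin 3)) = ∅ by decide, h0] at hI02
    rw [show ({1} ∪ {2} : Finset (Fin 3)) = {1, 2} by decide,
      show ({1} ∩ {2} : Finset (Fin 3)) = ∅ by decide, h0] at hI12
    rw [show ({0, 2} ∪ {1, 2} : Finset (Fin 3)) = {0, 1, 2} by decide,
      show ({0, 2} ∩ {1, 2} : Finset (Fin 3)) = {2} by decide] at hJ01
    rw [show ({0, 1} ∪ {1, 2} : Finset (Fin 3)) = {0, 1, 2} by decide,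
      show ({0, 1} ∩ {1, 2} : Finset (Fin 3)) = {1} by decide] at hJ02
    rw [show ({0, 1} ∪ {0, 2} : Finset (Fin 3)) = {0, 1, 2} by decide,
      show ({0, 1} ∩ {0, 2} : Finset (Fin 3)) = {0} by decide] at hJ12
    have modular_mem : ∀ a b c : ℝ,
        a • uniformRankOne {0} + b • uniformRankOne {1} + c • uniformRankOne {2} ∈ C :=
      fun a b c => cone.add_mem (cone.add_mem (single_mem _ _) (single_mem _ _)) (single_mem _ _)
    have pairs_mem : ∀ a b c : ℝ, 0 ≤ a → 0 ≤ b → 0 ≤ c →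
        a • uniformRankOne {0, 1} + b • uniformRankOne {0, 2} + c • uniformRankOne {1, 2} ∈ C :=
      fun a b c ha hb hc => cone.add_mem (cone.add_mem (cone.smul_mem zero_mem ha (one_mem _))
        (cone.smul_mem zero_mem hb (one_mem _))) (cone.smul_mem zero_mem hc (one_mem _))
    set t := g {0} + g {1} + g {2} - g {0, 1} - g {0, 2} - g {1, 2} + g {0, 1, 2} with ht
    rcases le_total 0 t with h | h
    · have h : g = ((g {0, 2} + g {1, 2} - g {0, 1, 2} - g {2}) • uniformRankOne {0, 1}
          + (g {0, 1} + g {1, 2} - g {0, 1, 2} - g {1}) • uniformRankOne {0, 2}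
          + (g {0, 1} + g {0, 2} - g {0, 1, 2} - g {0}) • uniformRankOne {1, 2})
          + t • uniformRankOne {0, 1, 2}
          + ((g {0, 1, 2} - g {1, 2}) • uniformRankOne {0}
          + (g {0, 1, 2} - g {0, 2}) • uniformRankOne {1}
          + (g {0, 1, 2} - g {0, 1}) • uniformRankOne {2}) := by
        ext α
        rcases hα α with rfl | rfl | rfl | rfl | rfl | rfl | rfl | rfl <;>
          simp [uniformRankOne, h0, ht] <;> ring
      rw [h]
      exact cone.add_mem (cone.add_mem (pairs_mem _ _ _ (by linarith) (by linarith) (by linarith))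
        (cone.smul_mem zero_mem ‹_› (one_mem _))) (modular_mem _ _ _)
    · have h23 : min (2 : ℝ) 3 = 2 := by norm_num
      have h : g = ((g {0} + g {1} - g {0, 1}) • uniformRankOne {0, 1}
          + (g {0} + g {2} - g {0, 2}) • uniformRankOne {0, 2}
          + (g {1} + g {2} - g {1, 2}) • uniformRankOne {1, 2})
          + (-t) • uniformRankTwo 3
          + ((g {0, 1, 2} - g {1, 2}) • uniformRankOne {0}
          + (g {0, 1, 2} - g {0, 2}) • uniformRankOne {1}
          + (g {0, 1, 2} - g {0, 1}) • uniformRankOne {2}) := by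
        ext α
        rcases hα α with rfl | rfl | rfl | rfl | rfl | rfl | rfl | rfl <;>
          simp [uniformRankOne, uniformRankTwo, h0, ht, h23] <;> ring
      rw [h]
      exact cone.add_mem (cone.add_mem (pairs_mem _ _ _ (by linarith) (by linarith) (by linarith))
        (cone.smul_mem zero_mem (neg_nonneg.2 ‹_›) two_mem)) (modular_mem _ _ _)

section LogDet

open Filter Topology

variable {ι : Type*} [Fintype ι] [DecidableEq ι]

theorem Matrix.IsHermitian.det_one_add_smul {B : Matrix ι ι ℝ} (hB : B.IsHermitian) (t : ℝ) :
    (1 + t • B).det = ∏ i, (1 + t * hB.eigenvalues i) := by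
  have hU : (hB.eigenvectorUnitary : Matrix ι ι ℝ) * star (hB.eigenvectorUnitary : Matrix ι ι ℝ)
      = 1 := Unitary.mul_star_self_of_mem hB.eigenvectorUnitary.2
  have h : 1 + t • B = (hB.eigenvectorUnitary : Matrix ι ι ℝ) *
      Matrix.diagonal (fun i => 1 + t * hB.eigenvalues i) *
        star (hB.eigenvectorUnitary : Matrix ι ι ℝ) := by
    conv_lhs => rw [hB.spectral_theorem, Unitary.conjStarAlgAut_apply]
    have hD : Matrix.diagonal (fun i => 1 + t * hB.eigenvalues i)
        = (1 : Matrix ι ι ℝ) + t • Matrix.diagonal (RCLike.ofReal ∘ hB.eigenvalues) := by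
      ext i j
      rcases eq_or_ne i j with rfl | hij <;> simp [*]
    rw [hD, mul_add, add_mul, mul_one, hU, Matrix.mul_smul,
      Matrix.smul_mul]
  rw [h, Matrix.det_mul_right_comm, hU, one_mul, Matrix.det_diagonal]

theorem tendsto_log_one_add_mul_div_log {a : ℝ} (ha : 0 ≤ a) :
    Tendsto (fun t => Real.log (1 + t * a) / Real.log t) atTop (𝓝 (if a ≠ 0 then 1 else 0)) := by
  rcases ha.eq_or_lt with rfl | ha
  · simp
  rw [if_pos ha.ne']
  have h₁ : Tendsto (fun t : ℝ => Real.log (t⁻¹ + a)) atTop (𝓝 (Real.log a)) := by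
    have := (tendsto_inv_atTop_zero (𝕜 := ℝ)).add_const a
    rw [zero_add] at this
    exact this.log ha.ne'
  have h₂ := (h₁.div_atTop Real.tendsto_log_atTop).const_add 1
  rw [add_zero] at h₂
  refine h₂.congr' ?_
  filter_upwards [eventually_gt_atTop 1] with t ht
  have ht0 : t ≠ 0 := by positivity
  have h : 1 + t * a = t * (t⁻¹ + a) := by field_simp
  rw [h, Real.log_mul ht0 (by positivity), add_div, div_self (Real.log_pos ht).ne']

theorem Matrix.PosSemidef.tendsto_log_det_one_add_smul {B : Matrix ι ι ℝ} (hB : B.PosSemidef) :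
    Tendsto (fun t : ℝ => Real.log (1 + t • B).det / Real.log t) atTop (𝓝 (B.rank : ℝ)) := by
  have h : (B.rank : ℝ) = ∑ i, if hB.1.eigenvalues i ≠ 0 then (1 : ℝ) else 0 := by
    rw [hB.1.rank_eq_card_non_zero_eigs, Fintype.card_subtype, Finset.card_filter]
    push_cast
    rfl
  rw [h]
  refine (tendsto_finsetSum _ fun i _ =>
    tendsto_log_one_add_mul_div_log (hB.eigenvalues_nonneg i)).congr' ?_
  filter_upwards [eventually_gt_atTop 0] with t ht
  rw [hB.1.det_one_add_smul, Real.log_prod, Finset.sum_div]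
  intro i _
  have := hB.eigenvalues_nonneg i
  positivity

end LogDet

section GaussianInnerBound

open Filter Topology

theorem mem_ccc_isSGaussian_of_tendsto {n : ℕ} {g : Finset (Fin n) → ℝ}
    {K : ℝ → Matrix (Fin n) (Fin n) ℝ} (hK : ∀ᶠ t in atTop, (K t).PosDef)
    (hg : ∀ α, Tendsto (fun t => Real.log (principalSub (K t) α).det / Real.log t) atTop
      (𝓝 (g α))) :
    g ∈ ccc {g : Finset (Fin n) → ℝ | IsSGaussian n g} := by
  let e (t : ℝ) (α : Finset (Fin n)) : ℝ := 1 / 2 * Real.logb 2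
    ((2 * Real.pi * Real.exp 1) ^ α.card * (principalSub (K t) α).det)
  have cone := isClosedConvexCone_ccc {g : Finset (Fin n) → ℝ | IsSGaussian n g}
  refine cone.1.mem_of_tendsto (f := fun t : ℝ => (2 * Real.log 2 / Real.log t) • e t)
    (tendsto_pi_nhds.2 fun α => ?_) ?_ (b := atTop)
  · have h₁ : Tendsto (fun t => α.card * Real.log (2 * Real.pi * Real.exp 1) / Real.log t) atTop
        (𝓝 0) := tendsto_const_nhds.div_atTop Real.tendsto_log_atTop
    have h₂ := h₁.add (hg α)
    rw [zero_add] at h₂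
    refine h₂.congr' ?_
    filter_upwards [hK] with t ht
    have hdet : (principalSub (K t) α).det ≠ 0 :=
      (ht.submatrix Subtype.val_injective).det_pos.ne'
    have hlog : Real.log 2 ≠ 0 := (Real.log_pos one_lt_two).ne'
    simp only [e, Pi.smul_apply, smul_eq_mul]
    rw [Real.logb, Real.log_mul (by positivity) hdet, Real.log_pow]
    field_simp
  · filter_upwards [hK, eventually_gt_atTop 1] with t ht h1
    exact cone.2.2 _ (div_pos (mul_pos two_pos (Real.log_pos one_lt_two)) (Real.log_pos h1)) _
      (subset_ccc _ ⟨K t, ht, fun α => rfl⟩)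

theorem IsSRepresentable.mem_ccc_isSGaussian {n : ℕ} {g : Finset (Fin n) → ℝ}
    (hg : IsSRepresentable n g) : g ∈ ccc {g : Finset (Fin n) → ℝ | IsSGaussian n g} := by
  obtain ⟨k, A, hA⟩ := hg
  refine mem_ccc_isSGaussian_of_tendsto
    (K := fun t => 1 + t • (Matrix.of A * (Matrix.of A).transpose)) ?_ fun α => ?_
  · filter_upwards [eventually_ge_atTop 0] with t ht
    exact Matrix.PosDef.one.add_posSemidef
      ((Matrix.posSemidef_self_mul_conjTranspose (Matrix.of A)).smul ht)
  · let M : Matrix {i // i ∈ α} (Fin k) ℝ := Matrix.of fun i => A i.1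
    have hM : (M * M.transpose).PosSemidef := Matrix.posSemidef_self_mul_conjTranspose M
    have hrank : g α = (M * M.transpose).rank := by
      have hrow : Set.range M.row = A '' (α : Set (Fin n)) := by
        rw [Set.image_eq_range]
        rfl
      rw [hA, Matrix.rank_self_mul_transpose, Matrix.rank_eq_finrank_span_row, hrow]
    rw [hrank]
    refine hM.tendsto_log_det_one_add_smul.congr fun t => ?_
    congr 3
    ext i j
    simp only [principalSub, Matrix.submatrix_apply, Matrix.add_apply, Matrix.smul_apply,
      Matrix.mul_apply, Matrix.one_apply, Subtype.ext_iff]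
    rfl

theorem phiFn_mem_ccc_isSGaussian {n : ℕ} (i : Fin n) :
    phiFn n i ∈ ccc {g : Finset (Fin n) → ℝ | IsSGaussian n g} := by
  refine mem_ccc_isSGaussian_of_tendsto
    (K := fun t => Matrix.diagonal fun j => if j = i then t⁻¹ else 1) ?_ fun α => ?_
  · filter_upwards [eventually_gt_atTop 0] with t ht
    refine Matrix.PosDef.diagonal fun j => ?_
    split_ifs <;> positivity
  · have hdet (t : ℝ) : (principalSub (Matrix.diagonal fun j => if j = i then t⁻¹ else 1) α).det
        = if i ∈ α then t⁻¹ else 1 := by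
      rw [principalSub, Matrix.submatrix_diagonal _ _ Subtype.val_injective, Matrix.det_diagonal]
      simp only [Function.comp_apply]
      rw [Finset.prod_coe_sort α (fun j => if j = i then t⁻¹ else 1), Finset.prod_ite_eq']
    refine tendsto_const_nhds.congr' ?_
    filter_upwards [eventually_gt_atTop 1] with t ht
    rw [hdet, phiFn]
    split_ifs
    · rw [Real.log_inv, neg_div, div_self (Real.log_pos ht).ne']
    · simp

end GaussianInnerBound

section DifferentialEntropy

theorem ae_pos_comp_of_map_eq_withDensity {Ω E : Type*} [MeasurableSpace Ω] [MeasurableSpace E]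
    {μ : Measure Ω} {ν : Measure E} {Y : Ω → E} (hY : Measurable Y) {p : E → ℝ}
    (hp : Measurable p) (h : μ.map Y = ν.withDensity fun x => ENNReal.ofReal (p x)) :
    ∀ᵐ ω ∂μ, 0 < p (Y ω) := by
  refine ae_of_ae_map hY.aemeasurable (p := fun x => 0 < p x) ?_
  rw [h, ae_withDensity_iff hp.ennreal_ofReal]
  exact Filter.Eventually.of_forall fun x hx => ENNReal.ofReal_pos.1 (pos_iff_ne_zero.2 hx)

theorem ae_lintegral_density_eq {Ω U W : Type*} [MeasurableSpace Ω] [MeasurableSpace U]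
    [MeasurableSpace W] {μ : Measure Ω} {ν₁ : Measure U} {ν₃ : Measure W} [SFinite ν₁]
    [SigmaFinite ν₃] {A : Ω → U} {C : Ω → W} (hA : Measurable A) (hC : Measurable C)
    {p : U × W → ℝ} {r : W → ℝ} (hp : Measurable p) (hr : Measurable r)
    (hpμ : μ.map (fun ω => (A ω, C ω)) = (ν₁.prod ν₃).withDensity fun x => ENNReal.ofReal (p x))
    (hrμ : μ.map C = ν₃.withDensity fun x => ENNReal.ofReal (r x)) [IsFiniteMeasure μ] :
    ∀ᵐ c ∂ν₃, ∫⁻ a, ENNReal.ofReal (p (a, c)) ∂ν₁ = ENNReal.ofReal (r c) := by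
  have hmeas : Measurable fun c => ∫⁻ a, ENNReal.ofReal (p (a, c)) ∂ν₁ :=
    hp.ennreal_ofReal.lintegral_prod_left'
  have h : ν₃.withDensity (fun c => ∫⁻ a, ENNReal.ofReal (p (a, c)) ∂ν₁)
      = ν₃.withDensity fun x => ENNReal.ofReal (r x) := by
    ext s hs
    have h₁ : μ.map C s = μ.map (fun ω => (A ω, C ω)) (Prod.snd ⁻¹' s) := by
      rw [Measure.map_apply hC hs, Measure.map_apply (hA.prodMk hC) (measurable_snd hs)]
      rfl
    rw [← hrμ, h₁, hpμ, withDensity_apply _ hs, withDensity_apply _ (measurable_snd hs),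
      ← lintegral_indicator hs, ← lintegral_indicator (measurable_snd hs),
      lintegral_prod_symm _ (hp.ennreal_ofReal.indicator (measurable_snd hs)).aemeasurable]
    refine lintegral_congr fun c => ?_
    by_cases hc : c ∈ s <;> simp [Set.indicator, hc]
  have hfin : ∫⁻ c, ENNReal.ofReal (r c) ∂ν₃ ≠ ⊤ := by
    rw [← setLIntegral_univ, ← withDensity_apply _ MeasurableSet.univ, ← hrμ]
    exact measure_ne_top _ _
  refine (withDensity_eq_iff hmeas.aemeasurable hr.ennreal_ofReal.aemeasurable ?_).1 h
  rwa [← setLIntegral_univ, ← withDensity_apply _ MeasurableSet.univ, h,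
    withDensity_apply _ MeasurableSet.univ, setLIntegral_univ]

theorem integral_log_density_add_le {Ω U V W : Type*} [MeasurableSpace Ω] [MeasurableSpace U]
    [MeasurableSpace V] [MeasurableSpace W] {μ : Measure Ω} [IsProbabilityMeasure μ]
    {ν₁ : Measure U} {ν₂ : Measure V} {ν₃ : Measure W} [SigmaFinite ν₁] [SigmaFinite ν₂]
    [SigmaFinite ν₃] {A : Ω → U} {B : Ω → V} {C : Ω → W} (hA : Measurable A) (hB : Measurable B)
    (hC : Measurable C) {p : U × W → ℝ} {q : V × W → ℝ} {f : U × V × W → ℝ} {r : W → ℝ}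
    (hp : Measurable p) (hq : Measurable q) (hf : Measurable f) (hr : Measurable r)
    (hp0 : ∀ x, 0 ≤ p x) (hq0 : ∀ x, 0 ≤ q x)
    (hpμ : μ.map (fun ω => (A ω, C ω)) = (ν₁.prod ν₃).withDensity fun x => ENNReal.ofReal (p x))
    (hqμ : μ.map (fun ω => (B ω, C ω)) = (ν₂.prod ν₃).withDensity fun x => ENNReal.ofReal (q x))
    (hfμ : μ.map (fun ω => (A ω, B ω, C ω))
      = (ν₁.prod (ν₂.prod ν₃)).withDensity fun x => ENNReal.ofReal (f x))
    (hrμ : μ.map C = ν₃.withDensity fun x => ENNReal.ofReal (r x))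
    (hpi : Integrable (fun ω => Real.log (p (A ω, C ω))) μ)
    (hqi : Integrable (fun ω => Real.log (q (B ω, C ω))) μ)
    (hfi : Integrable (fun ω => Real.log (f (A ω, B ω, C ω))) μ)
    (hri : Integrable (fun ω => Real.log (r (C ω))) μ) :
    ∫ ω, Real.log (p (A ω, C ω)) ∂μ + ∫ ω, Real.log (q (B ω, C ω)) ∂μ
      ≤ ∫ ω, Real.log (f (A ω, B ω, C ω)) ∂μ + ∫ ω, Real.log (r (C ω)) ∂μ := by
  have hp_pos := ae_pos_comp_of_map_eq_withDensity (hA.prodMk hC) hp hpμ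
  have hq_pos := ae_pos_comp_of_map_eq_withDensity (hB.prodMk hC) hq hqμ
  have hf_pos := ae_pos_comp_of_map_eq_withDensity (hA.prodMk (hB.prodMk hC)) hf hfμ
  have hr_pos := ae_pos_comp_of_map_eq_withDensity hC hr hrμ
  have hp_marg := ae_lintegral_density_eq hA hC hp hr hpμ hrμ
  have hq_marg := ae_lintegral_density_eq hB hC hq hr hqμ hrμ
  let ρ : U × V × W → ℝ := fun x =>
    p (x.1, x.2.2) * q x.2 / (r x.2.2 * f x)
  have hρ : Measurable ρ := by fun_prop
  have hρ_le : ∫⁻ ω, ENNReal.ofReal (ρ (A ω, B ω, C ω)) ∂μ ≤ 1 := by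
    let P : U × W → ENNReal := fun x => ENNReal.ofReal (p x)
    let Q : V × W → ENNReal := fun x => ENNReal.ofReal (q x)
    let R : W → ENNReal := fun x => ENNReal.ofReal (r x)
    have hP : Measurable P := hp.ennreal_ofReal
    have hQ : Measurable Q := hq.ennreal_ofReal
    have hR : Measurable R := hr.ennreal_ofReal
    calc ∫⁻ ω, ENNReal.ofReal (ρ (A ω, B ω, C ω)) ∂μ
        = ∫⁻ x, ENNReal.ofReal (f x) * ENNReal.ofReal (ρ x) ∂(ν₁.prod (ν₂.prod ν₃)) := by
          rw [← lintegral_map (f := fun x => ENNReal.ofReal (ρ x)) hρ.ennreal_ofReal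
            (hA.prodMk (hB.prodMk hC)), hfμ,
            lintegral_withDensity_eq_lintegral_mul _ hf.ennreal_ofReal hρ.ennreal_ofReal]
          rfl
      _ ≤ ∫⁻ x, P (x.1, x.2.2) * (Q x.2 * (R x.2.2)⁻¹) ∂(ν₁.prod (ν₂.prod ν₃)) := by
          refine lintegral_mono fun x => ?_
          rcases le_or_gt (f x) 0 with hfx | hfx
          · simp [ENNReal.ofReal_of_nonpos hfx]
          have hpq := mul_nonneg (hp0 (x.1, x.2.2)) (hq0 x.2)
          rcases le_or_gt (r x.2.2) 0 with hrx | hrx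
          · have : ρ x ≤ 0 :=
              div_nonpos_of_nonneg_of_nonpos hpq (mul_nonpos_of_nonpos_of_nonneg hrx hfx.le)
            simp [ENNReal.ofReal_of_nonpos this]
          · have : f x * ρ x = p (x.1, x.2.2) * (q x.2 * (r x.2.2)⁻¹) := by
              simp only [ρ]
              field_simp
            simp only [P, Q, R]
            rw [← ENNReal.ofReal_mul hfx.le, this, ENNReal.ofReal_mul (hp0 _),
              ENNReal.ofReal_mul (hq0 _), ENNReal.ofReal_inv_of_pos hrx]
      _ = ∫⁻ y, (∫⁻ a, P (a, y.2) ∂ν₁) * (Q y * (R y.2)⁻¹) ∂(ν₂.prod ν₃) := by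
          rw [lintegral_prod_symm _ (by fun_prop)]
          refine lintegral_congr fun y => ?_
          rw [← lintegral_mul_const (f := fun a => P (a, y.2)) _ (by fun_prop)]
      _ = ∫⁻ c, (∫⁻ a, P (a, c) ∂ν₁) * ((∫⁻ b, Q (b, c) ∂ν₂) * (R c)⁻¹) ∂ν₃ := by
          have : Measurable fun c => ∫⁻ a, P (a, c) ∂ν₁ := hP.lintegral_prod_left'
          rw [lintegral_prod_symm _ (by fun_prop)]
          refine lintegral_congr fun c => ?_
          rw [← lintegral_mul_const (f := fun b => Q (b, c)) _ (by fun_prop),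
            ← lintegral_const_mul (f := fun b => Q (b, c) * (R c)⁻¹) _ (by fun_prop)]
      _ = ∫⁻ c, R c * (R c * (R c)⁻¹) ∂ν₃ := by
          refine lintegral_congr_ae ?_
          filter_upwards [hp_marg, hq_marg] with c h₁ h₂
          rw [h₁, h₂]
      _ ≤ ∫⁻ c, R c ∂ν₃ :=
          lintegral_mono fun c => mul_le_of_le_one_right' (ENNReal.mul_inv_le_one _)
      _ = 1 := by
          rw [← setLIntegral_univ, ← withDensity_apply _ MeasurableSet.univ, ← hrμ,
            Measure.map_apply hC MeasurableSet.univ, Set.preimage_univ, measure_univ]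
  have hρ_nonneg : 0 ≤ᵐ[μ] fun ω => ρ (A ω, B ω, C ω) := by
    filter_upwards [hp_pos, hq_pos, hf_pos, hr_pos] with ω h₁ h₂ h₃ h₄
    exact (div_pos (mul_pos h₁ h₂) (mul_pos h₄ h₃)).le
  have hρ_comp : Measurable fun ω => ρ (A ω, B ω, C ω) := by fun_prop
  have hρ_int : Integrable (fun ω => ρ (A ω, B ω, C ω)) μ :=
    (lintegral_ofReal_ne_top_iff_integrable hρ_comp.aestronglyMeasurable hρ_nonneg).1
      (ne_top_of_le_ne_top ENNReal.one_ne_top hρ_le)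
  have hρ_integral : ∫ ω, ρ (A ω, B ω, C ω) ∂μ ≤ 1 := by
    rw [integral_eq_lintegral_of_nonneg_ae hρ_nonneg hρ_comp.aestronglyMeasurable]
    exact ENNReal.toReal_le_of_le_ofReal zero_le_one (by simpa using hρ_le)
  have hρ_sub : Integrable (fun ω => ρ (A ω, B ω, C ω) - 1) μ := hρ_int.sub (integrable_const _)
  have hfr : Integrable (fun ω => Real.log (f (A ω, B ω, C ω)) + Real.log (r (C ω))) μ :=
    hfi.add hri
  have hle : ∫ ω, (Real.log (p (A ω, C ω)) + Real.log (q (B ω, C ω))) ∂μ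
      ≤ ∫ ω, (Real.log (f (A ω, B ω, C ω)) + Real.log (r (C ω))
        + (ρ (A ω, B ω, C ω) - 1)) ∂μ := by
    refine integral_mono_ae (hpi.add hqi)
      (hfr.add hρ_sub) ?_
    filter_upwards [hp_pos, hq_pos, hf_pos, hr_pos] with ω h₁ h₂ h₃ h₄
    have h := Real.log_le_sub_one_of_pos (div_pos (mul_pos h₁ h₂) (mul_pos h₄ h₃))
    rw [Real.log_div (by positivity) (by positivity), Real.log_mul h₁.ne' h₂.ne',
      Real.log_mul h₄.ne' h₃.ne'] at h
    simp only [ρ]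
    linarith
  rw [integral_add hpi hqi, integral_add hfr hρ_sub,
    integral_add hfi hri, integral_sub hρ_int (integrable_const _)] at hle
  simp only [integral_const, probReal_univ, smul_eq_mul, mul_one] at hle
  linarith

theorem integrable_log_density_comp_iff {Ω E : Type*} [MeasurableSpace Ω] [MeasurableSpace E]
    {μ : Measure Ω} {ν : Measure E} {Y : Ω → E} (hY : Measurable Y) {f : E → ℝ}
    (hf : Measurable f) (hf0 : ∀ x, 0 ≤ f x)
    (h : μ.map Y = ν.withDensity fun x => ENNReal.ofReal (f x)) :
    Integrable (fun ω => Real.log (f (Y ω))) μ ↔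
      Integrable (fun x => f x * Real.logb 2 (f x)) ν := by
  have hlog : Measurable fun x => Real.log (f x) := by fun_prop
  have : (fun x => f x * Real.logb 2 (f x))
      = fun x => ((ENNReal.ofReal (f x)).toReal • Real.log (f x)) * (Real.log 2)⁻¹ := by
    ext x
    rw [ENNReal.toReal_ofReal (hf0 x), smul_eq_mul, Real.logb, div_eq_mul_inv, mul_assoc]
  rw [this, integrable_mul_const_iff (inv_ne_zero (Real.log_pos one_lt_two).ne').isUnit,
    ← integrable_withDensity_iff_integrable_smul' hf.ennreal_ofReal (by simp), ← h,
    integrable_map_measure hlog.aestronglyMeasurable hY.aemeasurable]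
  rfl

theorem integral_mul_logb_density {Ω E : Type*} [MeasurableSpace Ω] [MeasurableSpace E]
    {μ : Measure Ω} {ν : Measure E} {Y : Ω → E} (hY : Measurable Y) {f : E → ℝ}
    (hf : Measurable f) (hf0 : ∀ x, 0 ≤ f x)
    (h : μ.map Y = ν.withDensity fun x => ENNReal.ofReal (f x)) :
    ∫ x, f x * Real.logb 2 (f x) ∂ν = (∫ ω, Real.log (f (Y ω)) ∂μ) / Real.log 2 := by
  have hlog : Measurable fun x => Real.log (f x) := by fun_prop
  rw [← integral_map (f := fun x => Real.log (f x)) hY.aemeasurable hlog.aestronglyMeasurable, h,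
    integral_withDensity_eq_integral_toReal_smul hf.ennreal_ofReal (by simp),
    ← integral_div]
  refine integral_congr_ae (Filter.Eventually.of_forall fun x => ?_)
  simp only [ENNReal.toReal_ofReal (hf0 x), smul_eq_mul, Real.logb, mul_div_assoc]

theorem map_eq_withDensity_of_measurePreserving {Ω E F : Type*} [MeasurableSpace Ω]
    [MeasurableSpace E] [MeasurableSpace F] {μ : Measure Ω} {ν : Measure E} {ν' : Measure F}
    (e : E ≃ᵐ F) (he : MeasurePreserving e ν ν') {Y : Ω → E} (hY : Measurable Y)
    {d : F → ENNReal} (h : μ.map (fun ω => e (Y ω)) = ν'.withDensity d) :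
    μ.map Y = ν.withDensity fun x => d (e x) := by
  ext s hs
  have h₁ : MeasurableSet (e.symm ⁻¹' s) := e.symm.measurable hs
  have h₂ : e ⁻¹' (e.symm ⁻¹' s) = s := by ext; simp
  have h₃ := congrArg (fun m : Measure F => m (e.symm ⁻¹' s)) h
  rw [Measure.map_apply (f := fun ω => e (Y ω)) (e.measurable.comp hY) h₁, withDensity_apply _ h₁,
    ← he.setLIntegral_comp_preimage_emb e.measurableEmbedding, h₂] at h₃
  rw [Measure.map_apply hY hs, withDensity_apply _ hs, ← h₃]
  congr 1
  ext ω
  simp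

theorem SEntropyData.exists_density {n : ℕ} {Ω : Type} [MeasureSpace Ω] {X : Fin n → Ω → ℝ}
    {g : Finset (Fin n) → ℝ} (h : SEntropyData n Ω X g) (α : Finset (Fin n)) :
    ∃ f : ({i // i ∈ α} → ℝ) → ℝ, Measurable f ∧ (∀ x, 0 ≤ f x) ∧
      Measure.map (fun ω (i : {i // i ∈ α}) => X i.1 ω) volume
        = volume.withDensity (fun x => ENNReal.ofReal (f x)) ∧
      Integrable (fun ω => Real.log (f fun i : {i // i ∈ α} => X i.1 ω)) ∧
      g α = -((∫ ω, Real.log (f fun i : {i // i ∈ α} => X i.1 ω)) / Real.log 2) := by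
  obtain ⟨hprob, hX, -, hempty, hα⟩ := h
  have hXα : Measurable fun ω (i : {i // i ∈ α}) => X i.1 ω :=
    measurable_pi_lambda _ fun i => (measurable_pi_apply i.1).comp hX
  rcases α.eq_empty_or_nonempty with rfl | hne
  · refine ⟨fun _ => 1, measurable_const, fun _ => zero_le_one, ?_, by simp, by simpa using hempty⟩
    have hvol : (volume : Measure ({i // i ∈ (∅ : Finset (Fin n))} → ℝ))
        = Measure.dirac isEmptyElim := Measure.pi_of_empty _ _
    have : (fun ω (i : {i // i ∈ (∅ : Finset (Fin n))}) => X i.1 ω) = fun _ => isEmptyElim :=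
      funext fun _ => Subsingleton.elim _ _
    rw [this, Measure.map_const, hvol]
    simp
  · obtain ⟨f, hf, hf0, hlaw, hint, hg⟩ := hα α hne
    exact ⟨f, hf, hf0, hlaw, (integrable_log_density_comp_iff hXα hf hf0 hlaw).2 hint,
      by rw [hg, integral_mul_logb_density hXα hf hf0 hlaw]⟩

theorem SEntropyData.submodular_disjoint {n : ℕ} {Ω : Type} [MeasureSpace Ω] {X : Fin n → Ω → ℝ}
    {g : Finset (Fin n) → ℝ} (h : SEntropyData n Ω X g) {s t u : Finset (Fin n)}
    (hsu : Disjoint s u) (htu : Disjoint t u) (hst : Disjoint s t) :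
    g (s ∪ (t ∪ u)) + g u ≤ g (s ∪ u) + g (t ∪ u) := by
  have := h.1
  have hX (α : Finset (Fin n)) : Measurable fun ω (i : {i // i ∈ α}) => X i.1 ω :=
    measurable_pi_lambda _ fun i => (measurable_pi_apply i.1).comp h.2.1
  obtain ⟨p, hp, hp0, hpμ, hpi, hpg⟩ := h.exists_density (s ∪ u)
  obtain ⟨q, hq, hq0, hqμ, hqi, hqg⟩ := h.exists_density (t ∪ u)
  obtain ⟨f, hf, -, hfμ, hfi, hfg⟩ := h.exists_density (s ∪ (t ∪ u))
  obtain ⟨r, hr, -, hrμ, hri, hrg⟩ := h.exists_density u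
  have hstu : Disjoint s (t ∪ u) := Finset.disjoint_union_right.2 ⟨hst, hsu⟩
  let e₁ := MeasurableEquiv.piFinsetUnion (fun _ : Fin n => ℝ) hsu
  let e₂ := MeasurableEquiv.piFinsetUnion (fun _ : Fin n => ℝ) htu
  let e₃ := ((MeasurableEquiv.refl ({i // i ∈ s} → ℝ)).prodCongr e₂).trans
    (MeasurableEquiv.piFinsetUnion (fun _ : Fin n => ℝ) hstu)
  have he₁ : MeasurePreserving e₁ (volume.prod volume) volume :=
    volume_preserving_piFinsetUnion (fun _ : Fin n => ℝ) hsu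
  have he₂ : MeasurePreserving e₂ (volume.prod volume) volume :=
    volume_preserving_piFinsetUnion (fun _ : Fin n => ℝ) htu
  have he₃ : MeasurePreserving e₃ (volume.prod (volume.prod volume)) volume :=
    (volume_preserving_piFinsetUnion (fun _ : Fin n => ℝ) hstu).comp
      ((MeasurePreserving.id volume).prod he₂)
  have hglue {a b : Finset (Fin n)} (hab : Disjoint a b) (ω : Ω) :
      MeasurableEquiv.piFinsetUnion (fun _ : Fin n => ℝ) hab
        (fun i : {i // i ∈ a} => X i.1 ω, fun i : {i // i ∈ b} => X i.1 ω)
        = fun i : {i // i ∈ a ∪ b} => X i.1 ω := by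
    refine (MeasurableEquiv.symm_apply_eq _).1 ?_ |>.symm
    rfl
  have h₁ (ω : Ω) : e₁ (fun i => X i.1 ω, fun i => X i.1 ω) = fun i => X i.1 ω := hglue hsu ω
  have h₂ (ω : Ω) : e₂ (fun i => X i.1 ω, fun i => X i.1 ω) = fun i => X i.1 ω := hglue htu ω
  have h₃ (ω : Ω) : e₃ (fun i => X i.1 ω, fun i => X i.1 ω, fun i => X i.1 ω)
      = fun i => X i.1 ω := by
    rw [← hglue hstu ω, ← hglue htu ω]
    rfl
  have key := integral_log_density_add_le (hX s) (hX t) (hX u)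
    (hp.comp e₁.measurable) (hq.comp e₂.measurable) (hf.comp e₃.measurable) hr
    (fun _ => hp0 _) (fun _ => hq0 _)
    (map_eq_withDensity_of_measurePreserving (d := fun x => ENNReal.ofReal (p x)) e₁ he₁
      ((hX s).prodMk (hX u)) (by simpa only [h₁] using hpμ))
    (map_eq_withDensity_of_measurePreserving (d := fun x => ENNReal.ofReal (q x)) e₂ he₂
      ((hX t).prodMk (hX u)) (by simpa only [h₂] using hqμ))
    (map_eq_withDensity_of_measurePreserving (d := fun x => ENNReal.ofReal (f x)) e₃ he₃
      ((hX s).prodMk ((hX t).prodMk (hX u))) (by simpa only [h₃] using hfμ))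
    hrμ (by simpa only [Function.comp, h₁] using hpi) (by simpa only [Function.comp, h₂] using hqi)
    (by simpa only [Function.comp, h₃] using hfi) hri
  simp only [Function.comp, h₁, h₂, h₃] at key
  have h2 : 0 < Real.log 2 := Real.log_pos one_lt_two
  have := div_le_div_of_nonneg_right key h2.le
  rw [add_div, add_div] at this
  rw [hpg, hqg, hfg, hrg]
  linarith

theorem IsSEntropic.mem_submodularCone {n : ℕ} {g : Finset (Fin n) → ℝ} (hg : IsSEntropic n g) :
    g ∈ submodularCone n := by
  obtain ⟨Ω, m, X, h⟩ := hg
  refine ⟨h.2.2.2.1, fun α β => ?_⟩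
  have key := h.submodular_disjoint (s := α \ β) (t := β \ α) (u := α ∩ β)
    (Finset.disjoint_left.2 (by grind)) (Finset.disjoint_left.2 (by grind))
    (Finset.disjoint_left.2 (by grind))
  rwa [show α \ β ∪ (β \ α ∪ α ∩ β) = α ∪ β by grind, show α \ β ∪ α ∩ β = α by grind,
    show β \ α ∪ α ∩ β = β by grind] at key

end DifferentialEntropy

section Gaussian

open ProbabilityTheory Matrix

/-- The law of a vector of independent standard Gaussian variables. -/
def stdNormal (ι : Type*) [Fintype ι] : Measure (ι → ℝ) :=
  Measure.pi fun _ => gaussianReal 0 1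

instance (ι : Type*) [Fintype ι] : IsProbabilityMeasure (stdNormal ι) :=
  inferInstanceAs (IsProbabilityMeasure (Measure.pi fun _ => gaussianReal 0 1))

theorem stdNormal_eq_withDensity (ι : Type*) [Fintype ι] :
    stdNormal ι
      = volume.withDensity fun x => ENNReal.ofReal (∏ i, gaussianPDFReal 0 1 (x i)) := by
  refine Measure.pi_eq fun s hs => ?_
  have hint (i : ι) : Integrable (gaussianPDFReal 0 1) (volume.restrict (s i)) :=
    (integrable_gaussianPDFReal 0 1).restrict
  rw [withDensity_apply _ (MeasurableSet.univ_pi hs), volume_pi, Measure.restrict_pi_pi,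
    ← ofReal_integral_eq_lintegral_ofReal (Integrable.fintype_prod hint)
      (Filter.Eventually.of_forall fun x =>
        Finset.prod_nonneg fun i _ => gaussianPDFReal_nonneg 0 1 (x i)),
    integral_fintype_prod_eq_prod (f := fun _ => gaussianPDFReal 0 1),
    ENNReal.ofReal_prod_of_nonneg fun i _ =>
      integral_nonneg fun x => gaussianPDFReal_nonneg 0 1 x]
  refine Finset.prod_congr rfl fun i _ => ?_
  rw [gaussianReal_apply_eq_integral 0 one_ne_zero]

variable {ι κ : Type*} [Fintype ι] [Fintype κ]

theorem measurable_mulVec (A : Matrix ι κ ℝ) : Measurable A.mulVec :=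
  (Continuous.matrix_mulVec continuous_const continuous_id).measurable

theorem charFun_map_mulVec_stdNormal (C : Matrix ι κ ℝ) (t : EuclideanSpace ℝ ι) :
    charFun (((stdNormal κ).map C.mulVec).map (WithLp.toLp 2)) t
      = Complex.exp (-(((t.ofLp ⬝ᵥ (C * Cᵀ).mulVec t.ofLp : ℝ) : ℂ)) / 2) := by
  have h₁ := charFun_stdGaussian (WithLp.toLp 2 (Cᵀ.mulVec t.ofLp))
  rw [← map_pi_eq_stdGaussian, charFun_apply, integral_map (by fun_prop) (by fun_prop)] at h₁
  rw [Measure.map_map (by fun_prop) (measurable_mulVec C), charFun_apply,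
    integral_map
      ((by fun_prop : Measurable (WithLp.toLp 2)).comp (measurable_mulVec C)).aemeasurable
      (by fun_prop)]
  have h₂ (z : κ → ℝ) : inner ℝ (WithLp.toLp 2 (C.mulVec z)) t
      = inner ℝ (WithLp.toLp 2 z) (WithLp.toLp 2 (Cᵀ.mulVec t.ofLp)) := by
    simp [EuclideanSpace.inner_eq_star_dotProduct, Matrix.dotProduct_mulVec,
      Matrix.mulVec_transpose]
  have h₃ : t.ofLp ⬝ᵥ (C * Cᵀ).mulVec t.ofLp
      = ∑ i, (Cᵀ.mulVec t.ofLp i) ^ 2 := by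
    rw [← Matrix.mulVec_mulVec, Matrix.dotProduct_mulVec, ← Matrix.mulVec_transpose, dotProduct]
    simp [sq]
  simp only [Function.comp, h₂]
  refine h₁.trans ?_
  rw [← Complex.ofReal_pow, EuclideanSpace.real_norm_sq_eq, h₃]

theorem map_mulVec_stdNormal_congr {κ' : Type*} [Fintype κ'] {A : Matrix ι κ ℝ}
    {B : Matrix ι κ' ℝ} (h : A * Aᵀ = B * Bᵀ) :
    (stdNormal κ).map A.mulVec = (stdNormal κ').map B.mulVec := by
  have : ((stdNormal κ).map A.mulVec).map (WithLp.toLp 2)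
      = ((stdNormal κ').map B.mulVec).map (WithLp.toLp 2) := by
    refine Measure.ext_of_charFun (E := EuclideanSpace ℝ ι) ?_
    ext t
    rw [charFun_map_mulVec_stdNormal, charFun_map_mulVec_stdNormal, h]
  exact (MeasurableEquiv.toLp 2 (ι → ℝ)).map_measurableEquiv_injective this

theorem integrable_sq_stdNormal (i : ι) : Integrable (fun z : ι → ℝ => z i ^ 2) (stdNormal ι) :=
  (measurePreserving_eval (fun _ : ι => gaussianReal 0 1) i).integrable_comp_of_integrable
    (memLp_id_gaussianReal 2).integrable_sq

theorem integral_sq_stdNormal (i : ι) : ∫ z : ι → ℝ, z i ^ 2 ∂(stdNormal ι) = 1 := by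
  have h : ∫ x : ℝ, x ^ 2 ∂(gaussianReal 0 1) = 1 := by
    have := variance_id_gaussianReal (μ := 0) (v := 1)
    rw [variance_of_integral_eq_zero aemeasurable_id (by simp)] at this
    simpa using this
  rw [← h, ← (measurePreserving_eval (fun _ : ι => gaussianReal 0 1) i).map_eq,
    integral_map (measurable_pi_apply i).aemeasurable (by fun_prop)]
  rfl

variable [DecidableEq ι] {M : Matrix ι ι ℝ}

/-- The density of `M *ᵥ z` for a standard Gaussian vector `z`. -/
def mulVecDensity (M : Matrix ι ι ℝ) (x : ι → ℝ) : ℝ :=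
  |M.det⁻¹| * ∏ i, gaussianPDFReal 0 1 (M⁻¹.mulVec x i)

theorem measurable_mulVecDensity (M : Matrix ι ι ℝ) : Measurable (mulVecDensity M) :=
  measurable_const.mul <| Finset.measurable_fun_prod _ fun i _ =>
    (measurable_gaussianPDFReal 0 1).comp ((measurable_pi_apply i).comp (measurable_mulVec M⁻¹))

theorem mulVecDensity_nonneg (M : Matrix ι ι ℝ) (x : ι → ℝ) : 0 ≤ mulVecDensity M x :=
  mul_nonneg (abs_nonneg _) (Finset.prod_nonneg fun _ _ => gaussianPDFReal_nonneg 0 1 _)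

theorem map_mulVec_stdNormal (hM : M.det ≠ 0) :
    (stdNormal ι).map M.mulVec
      = volume.withDensity fun x => ENNReal.ofReal (mulVecDensity M x) := by
  have hinv (x : ι → ℝ) : M⁻¹.mulVec (M.mulVec x) = x := by
    rw [Matrix.mulVec_mulVec, Matrix.nonsing_inv_mul _ hM.isUnit, Matrix.one_mulVec]
  have hφ : Measurable fun x : ι → ℝ =>
      ENNReal.ofReal (∏ i, gaussianPDFReal 0 1 (M⁻¹.mulVec x i)) :=
    (Finset.measurable_fun_prod _ fun i _ => (measurable_gaussianPDFReal 0 1).comp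
      ((measurable_pi_apply i).comp (measurable_mulVec M⁻¹))).ennreal_ofReal
  have hvol : (volume : Measure (ι → ℝ)).map M.mulVec = ENNReal.ofReal |M.det⁻¹| • volume :=
    Real.map_matrix_volume_pi_eq_smul_volume_pi hM
  ext s hs
  have hs' := measurable_mulVec M hs
  rw [Measure.map_apply (measurable_mulVec M) hs, stdNormal_eq_withDensity,
    withDensity_apply _ hs', withDensity_apply _ hs]
  simp only [mulVecDensity, ENNReal.ofReal_mul (abs_nonneg _)]
  rw [lintegral_const_mul _ hφ, ← smul_eq_mul, ← lintegral_smul_measure, ← Measure.restrict_smul,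
    ← hvol, setLIntegral_map hs hφ (measurable_mulVec M)]
  simp only [hinv]

theorem log_mulVecDensity_mulVec (hM : M.det ≠ 0) (z : ι → ℝ) :
    Real.log (mulVecDensity M (M.mulVec z))
      = ∑ i, (-(z i ^ 2) / 2 - Real.log (2 * Real.pi) / 2) - Real.log |M.det| := by
  have hlog (x : ℝ) : Real.log (gaussianPDFReal 0 1 x)
      = -(x ^ 2) / 2 - Real.log (2 * Real.pi) / 2 := by
    rw [gaussianPDFReal, Real.log_mul (by positivity) (Real.exp_ne_zero _), Real.log_exp,
      Real.log_inv, Real.log_sqrt (by positivity)]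
    simp
    ring
  rw [mulVecDensity, Matrix.mulVec_mulVec, Matrix.nonsing_inv_mul _ hM.isUnit, Matrix.one_mulVec,
    Real.log_mul (by simpa using hM)
      (Finset.prod_ne_zero_iff.2 fun i _ => (gaussianPDFReal_pos 0 1 _ one_ne_zero).ne'),
    Real.log_prod fun i _ => (gaussianPDFReal_pos 0 1 _ one_ne_zero).ne', abs_inv, Real.log_inv]
  simp only [hlog]
  ring

theorem integrable_log_mulVecDensity (hM : M.det ≠ 0) :
    Integrable (fun z => Real.log (mulVecDensity M (M.mulVec z))) (stdNormal ι) := by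
  simp only [log_mulVecDensity_mulVec hM]
  exact (integrable_finsetSum _ fun i _ =>
    ((integrable_sq_stdNormal i).neg.div_const 2).sub (integrable_const _)).sub (integrable_const _)

theorem integral_log_mulVecDensity (hM : M.det ≠ 0) :
    ∫ z, Real.log (mulVecDensity M (M.mulVec z)) ∂(stdNormal ι)
      = -(1 / 2 * Real.log ((2 * Real.pi * Real.exp 1) ^ Fintype.card ι * M.det ^ 2)) := by
  have hi (i : ι) : Integrable (fun z : ι → ℝ => -(z i ^ 2) / 2) (stdNormal ι) :=
    (integrable_sq_stdNormal i).neg.div_const 2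
  have hi' (i : ι) : Integrable (fun z : ι → ℝ => -(z i ^ 2) / 2 - Real.log (2 * Real.pi) / 2)
      (stdNormal ι) := (hi i).sub (integrable_const _)
  simp only [log_mulVecDensity_mulVec hM]
  rw [integral_sub (integrable_finsetSum _ fun i _ => hi' i) (integrable_const _),
    integral_finsetSum _ fun i _ => hi' i]
  have hone (i : ι) : ∫ z : ι → ℝ, (-(z i ^ 2) / 2 - Real.log (2 * Real.pi) / 2) ∂(stdNormal ι)
      = -1 / 2 - Real.log (2 * Real.pi) / 2 := by
    rw [integral_sub (hi i) (integrable_const _), integral_div, integral_neg,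
      integral_sq_stdNormal]
    simp
  simp only [hone]
  rw [Real.log_mul (x := (2 * Real.pi * Real.exp 1) ^ Fintype.card ι) (by positivity)
      (by positivity), Real.log_pow, Real.log_pow,
    Real.log_mul (x := 2 * Real.pi) (by positivity) (Real.exp_ne_zero 1), Real.log_exp,
    Real.log_abs]
  simp
  ring

open scoped MatrixOrder in
theorem Matrix.PosDef.exists_mul_transpose_eq {K : Matrix ι ι ℝ} (hK : K.PosDef) :
    ∃ L : Matrix ι ι ℝ, L * L.transpose = K ∧ L.det ≠ 0 := by
  have hmul : CFC.sqrt K * CFC.sqrt K = K := CFC.sqrt_mul_sqrt_self K hK.posSemidef.nonneg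
  have hT : (CFC.sqrt K).transpose = CFC.sqrt K := by
    rw [← Matrix.conjTranspose_eq_transpose_of_trivial]
    exact (CFC.sqrt_nonneg K).isSelfAdjoint
  refine ⟨CFC.sqrt K, by rw [hT, hmul], fun h => hK.det_pos.ne' ?_⟩
  rw [← hmul, Matrix.det_mul, h, zero_mul]

end Gaussian

theorem IsSGaussian.isSEntropic {n : ℕ} {g : Finset (Fin n) → ℝ} (hg : IsSGaussian n g) :
    IsSEntropic n g := by
  obtain ⟨K, hK, hg⟩ := hg
  obtain ⟨L, hL, hLdet⟩ := hK.exists_mul_transpose_eq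
  refine ⟨Fin n → ℝ, ⟨stdNormal (Fin n)⟩, fun i z => L.mulVec z i, ?_⟩
  let : MeasureSpace (Fin n → ℝ) := ⟨stdNormal (Fin n)⟩
  refine ⟨inferInstanceAs (IsProbabilityMeasure (stdNormal (Fin n))), measurable_mulVec L,
    ⟨mulVecDensity L, measurable_mulVecDensity L, mulVecDensity_nonneg L,
      map_mulVec_stdNormal hLdet⟩, by simp [hg, principalSub], fun α _ => ?_⟩
  have hKα : (principalSub K α).PosDef := hK.submatrix Subtype.val_injective
  obtain ⟨M, hM, hMdet⟩ := hKα.exists_mul_transpose_eq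
  have hlaw : (stdNormal {i // i ∈ α}).map M.mulVec
      = (stdNormal (Fin n)).map (fun z (i : {i // i ∈ α}) => L.mulVec z i.1) := by
    refine map_mulVec_stdNormal_congr (B := L.submatrix Subtype.val id) ?_
    rw [hM, principalSub, ← hL]
    rfl
  have hm := measurable_mulVec M
  have hd := measurable_mulVecDensity M
  have hd0 := mulVecDensity_nonneg M
  have hMlaw := map_mulVec_stdNormal hMdet
  refine ⟨mulVecDensity M, hd, hd0, hlaw.symm.trans hMlaw,
    (integrable_log_density_comp_iff hm hd hd0 hMlaw).1 (integrable_log_mulVecDensity hMdet), ?_⟩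
  rw [integral_mul_logb_density hm hd hd0 hMlaw, integral_log_mulVecDensity hMdet, hg, ← hM,
    Matrix.det_mul, Matrix.det_transpose, Real.logb, Fintype.card_coe, ← sq]
  ring

/-- for `n ≤ 3` the bounds coincide:
`con(Ω_{s,n} ∪ {φⁿ₁,…,φⁿₙ}) = con(Υ_{s,n}) = con(γ*_{s,n})`. -/
theorem stmt7 (n : ℕ) (hn : n ≤ 3) :
    ccc ({g : Finset (Fin n) → ℝ | IsSRepresentable n g} ∪
        {g | ∃ i : Fin n, g = phiFn n i}) =
      ccc {g : Finset (Fin n) → ℝ | IsSGaussian n g} ∧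
    ccc {g : Finset (Fin n) → ℝ | IsSGaussian n g} =
      ccc {g : Finset (Fin n) → ℝ | IsSEntropic n g} := by
  have hΓ : {g : Finset (Fin n) → ℝ | IsSGaussian n g}
      ⊆ ccc {g : Finset (Fin n) → ℝ | IsSEntropic n g} :=
    fun g hg => subset_ccc _ (IsSGaussian.isSEntropic hg)
  have hinner : ccc ({g : Finset (Fin n) → ℝ | IsSRepresentable n g} ∪
      {g | ∃ i : Fin n, g = phiFn n i}) ⊆ ccc {g : Finset (Fin n) → ℝ | IsSGaussian n g} := by
    refine ccc_subset_ccc ?_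
    rintro g (hg | ⟨i, rfl⟩)
    · exact IsSRepresentable.mem_ccc_isSGaussian hg
    · exact phiFn_mem_ccc_isSGaussian i
  have houter : ccc {g : Finset (Fin n) → ℝ | IsSEntropic n g} ⊆
      ccc ({g : Finset (Fin n) → ℝ | IsSRepresentable n g} ∪
        {g | ∃ i : Fin n, g = phiFn n i}) :=
    (ccc_subset (isClosedConvexCone_submodularCone n)
      fun _ hg => IsSEntropic.mem_submodularCone hg).trans (submodularCone_subset hn)
  have hmid := ccc_subset_ccc hΓ
  exact ⟨hinner.antisymm (hmid.trans houter), hmid.antisymm (houter.trans hinner)⟩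

end
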